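/- If X is a connected, locally n-connected, separable metric space, then π_n(X, x) is countable for every x ∈ X. -/

import Mathlib

open scoped unitInterval Topology
open Set Filter

noncomputable instance homotopyGroupTopologicalSpace (N X : Type*) [TopologicalSpace X]
    (x : X) : TopologicalSpace (HomotopyGroup N X x) :=
  instTopologicalSpaceQuotient

/-- A based k-loop p is nullhomotopic within U if there is a homotopy rel the cube
boundary from p to the constant loop, taking all its values in U. -/
def GenLoop.NullHomotopicIn {X : Type*} [TopologicalSpace X] {k : ℕ} {y : X}
    (p : GenLoop (Fin k) X y) (U : Set X) : Prop :=
  ∃ H : ContinuousMap.HomotopyRel p.1 (ContinuousMap.const (Fin k → I) y)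
      (Cube.boundary (Fin k)),
    ∀ z, H z ∈ U

/-- X is locally n-connected: every point has arbitrarily small neighborhoods V inside
any neighborhood U such that π_k(V) → π_k(U) is trivial for all 0 ≤ k ≤ n and all
basepoints in V. -/
def LocallyNConnected (n : ℕ) (X : Type*) [TopologicalSpace X] : Prop :=
  ∀ (x : X) (U : Set X), IsOpen U → x ∈ U →
    ∃ V : Set X, IsOpen V ∧ x ∈ V ∧ V ⊆ U ∧
      ∀ k ≤ n, ∀ y ∈ V, ∀ p : GenLoop (Fin k) X y,
        (∀ t, p t ∈ V) → GenLoop.NullHomotopicIn p U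

section SphereExtension

open Metric

/-- Continuous functions on two closed sets agreeing on the overlap glue to a continuous function
on the union. -/
theorem exists_continuousOn_union {A B : Type*} [TopologicalSpace A] [TopologicalSpace B]
    {s t : Set A} {f g : A → B} (hs : IsClosed s) (ht : IsClosed t) (hf : ContinuousOn f s)
    (hg : ContinuousOn g t) (hfg : ∀ a ∈ s, a ∈ t → f a = g a) :
    ∃ F : A → B, ContinuousOn F (s ∪ t) ∧ EqOn F f s ∧ EqOn F g t := by
  classical
  have hFs : EqOn (s.piecewise f g) f s := piecewise_eqOn s f g
  have hFt : EqOn (s.piecewise f g) g t := fun a ha => by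
    by_cases has : a ∈ s
    · rw [hFs has, hfg a has ha]
    · exact piecewise_eq_of_notMem s f g has
  exact ⟨s.piecewise f g, (hf.congr hFs).union_of_isClosed (hg.congr hFt) hs ht, hFs, hFt⟩

/-- Every continuous map from the unit sphere of `E` to `V` extends to a continuous map from the
closed unit ball to `U`. -/
def SphereExtends (E : Type*) [NormedAddCommGroup E] {X : Type*} [TopologicalSpace X]
    (V U : Set X) : Prop :=
  ∀ f : E → X, ContinuousOn f (sphere 0 1) → MapsTo f (sphere 0 1) V →
    ∃ F : E → X, ContinuousOn F (closedBall 0 1) ∧ MapsTo F (closedBall 0 1) U ∧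
      EqOn F f (sphere 0 1)

/-- Every continuous map from the unit ball of `E` to `V` that is constant on the unit sphere is
nullhomotopic in `U` relative to the sphere. -/
def BallLoopsContract (E : Type*) [NormedAddCommGroup E] {X : Type*} [TopologicalSpace X]
    (V U : Set X) : Prop :=
  ∀ y ∈ V, ∀ p : E → X, ContinuousOn p (closedBall 0 1) → MapsTo p (closedBall 0 1) V →
    (∀ b ∈ sphere (0 : E) 1, p b = y) →
    ∃ K : ℝ × E → X, ContinuousOn K (Icc (-1) 1 ×ˢ closedBall 0 1) ∧
      MapsTo K (Icc (-1) 1 ×ˢ closedBall 0 1) U ∧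
      (∀ b ∈ closedBall (0 : E) 1, K (1, b) = p b) ∧
      (∀ b ∈ closedBall (0 : E) 1, K (-1, b) = y) ∧
      (∀ t ∈ Icc (-1 : ℝ) 1, ∀ b ∈ sphere (0 : E) 1, K (t, b) = y)

variable {E F X Y : Type*} [NormedAddCommGroup E] [NormedAddCommGroup F]
  [TopologicalSpace X] [TopologicalSpace Y]

theorem SphereExtends.mono {V V' U U' : Set X} (h : SphereExtends E V U) (hV : V' ⊆ V)
    (hU : U ⊆ U') : SphereExtends E V' U' := fun f hf hfV => by
  obtain ⟨G, hG, hGU, hGf⟩ := h f hf (hfV.mono_right hV)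
  exact ⟨G, hG, hGU.mono_right hU, hGf⟩

theorem SphereExtends.congr_homeomorph {V U : Set X} (h : SphereExtends E V U) (e : E ≃ₜ F)
    (he : ∀ b, ‖e b‖ = ‖b‖) : SphereExtends F V U := fun f hf hfV => by
  have he' : ∀ b, ‖e.symm b‖ = ‖b‖ := fun b => by rw [← he, e.apply_symm_apply]
  have hs : MapsTo e (sphere 0 1) (sphere 0 1) := fun b hb => by simpa [he] using hb
  have hs' : MapsTo e.symm (sphere 0 1) (sphere 0 1) := fun b hb => by simpa [he'] using hb
  have hb' : MapsTo e.symm (closedBall 0 1) (closedBall 0 1) := fun b hb => by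
    simpa [he'] using hb
  obtain ⟨G, hG, hGU, hGf⟩ := h (f ∘ e) (hf.comp e.continuous.continuousOn hs) (hfV.comp hs)
  refine ⟨G ∘ e.symm, hG.comp e.symm.continuous.continuousOn hb', hGU.comp hb', fun b hb => ?_⟩
  simp [hGf (hs' hb)]

theorem SphereExtends.preimage_homeomorph {V U : Set X} (h : SphereExtends E V U) (e : Y ≃ₜ X) :
    SphereExtends E (e ⁻¹' V) (e ⁻¹' U) := fun f hf hfV => by
  obtain ⟨G, hG, hGU, hGf⟩ := h (e ∘ f) (e.continuous.comp_continuousOn hf) hfV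
  refine ⟨e.symm ∘ G, e.symm.continuous.comp_continuousOn hG, fun b hb => ?_, fun b hb => ?_⟩
  · simpa using hGU hb
  · simp [hGf hb]

theorem closedBall_real_prod :
    closedBall (0 : ℝ × E) 1 = Icc (-1) 1 ×ˢ closedBall 0 1 := by
  rw [← Prod.mk_zero_zero, ← closedBall_prod_same, Real.closedBall_eq_Icc]
  norm_num

/-- The isomorphism `ℝ × ℝᵏ ≃ ℝᵏ⁺¹` preserves sup norms. -/
theorem norm_consEquivL (k : ℕ) (b : ℝ × (Fin k → ℝ)) :
    ‖Fin.consEquivL ℝ (fun _ : Fin (k + 1) => ℝ) b‖ = ‖b‖ := by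
  refine le_antisymm ((pi_norm_le_iff_of_nonneg (norm_nonneg _)).2 fun i => ?_)
    (max_le ?_ ((pi_norm_le_iff_of_nonneg (norm_nonneg _)).2 fun i => ?_))
  · refine Fin.cases ?_ (fun j => ?_) i
    · exact le_max_left _ _
    · exact (norm_le_pi_norm b.2 j).trans (le_max_right _ _)
  · exact norm_le_pi_norm (Fin.consEquivL ℝ (fun _ : Fin (k + 1) => ℝ) b) 0
  · exact norm_le_pi_norm (Fin.consEquivL ℝ (fun _ : Fin (k + 1) => ℝ) b) i.succ

theorem sphereExtends_fin_succ_iff {V U : Set X} {k : ℕ} :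
    SphereExtends (Fin (k + 1) → ℝ) V U ↔ SphereExtends (ℝ × (Fin k → ℝ)) V U := by
  have hn := norm_consEquivL k
  refine ⟨fun h => h.congr_homeomorph (Fin.consEquivL ℝ fun _ => ℝ).symm.toHomeomorph fun b => ?_,
    fun h => h.congr_homeomorph (Fin.consEquivL ℝ fun _ => ℝ).toHomeomorph hn⟩
  have := hn ((Fin.consEquivL ℝ fun _ => ℝ).symm b)
  rw [ContinuousLinearEquiv.apply_symm_apply] at this
  exact this.symm

variable [NormedSpace ℝ E]

/-- If a map on the unit sphere is homotopic within `U` to the restriction of a map from the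
closed ball to `U`, then it is itself such a restriction. -/
theorem exists_extension_of_homotopy {U : Set X} {f G : E → X} {N : ℝ × E → X}
    (hN : ContinuousOn N (Icc 0 1 ×ˢ sphere 0 1)) (hNU : MapsTo N (Icc 0 1 ×ˢ sphere 0 1) U)
    (hN0 : ∀ b ∈ sphere (0 : E) 1, N (0, b) = f b) (hN1 : ∀ b ∈ sphere (0 : E) 1, N (1, b) = G b)
    (hG : ContinuousOn G (closedBall 0 1)) (hGU : MapsTo G (closedBall 0 1) U) :
    ∃ F : E → X, ContinuousOn F (closedBall 0 1) ∧ MapsTo F (closedBall 0 1) U ∧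
      EqOn F f (sphere 0 1) := by
  have hin : MapsTo (fun b : E => (2 : ℝ) • b) (closedBall 0 (1 / 2)) (closedBall 0 1) := by
    intro b hb
    simp only [mem_closedBall, dist_zero_right, norm_smul, Real.norm_ofNat] at hb ⊢
    linarith
  have hout : MapsTo (fun b : E => (2 * (1 - ‖b‖), ‖b‖⁻¹ • b))
      {b | 1 / 2 ≤ ‖b‖ ∧ ‖b‖ ≤ 1} (Icc 0 1 ×ˢ sphere 0 1) := by
    rintro b ⟨h1, h2⟩
    refine ⟨⟨by simp only; linarith, by simp only; linarith⟩, ?_⟩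
    have : ‖b‖ ≠ 0 := by linarith
    simp [norm_smul, this]
  obtain ⟨F, hF, hF1, hF2⟩ := exists_continuousOn_union (s := closedBall (0 : E) (1 / 2))
    (t := {b : E | 1 / 2 ≤ ‖b‖ ∧ ‖b‖ ≤ 1}) (f := fun b => G ((2 : ℝ) • b))
    (g := fun b => N (2 * (1 - ‖b‖), ‖b‖⁻¹ • b)) isClosed_closedBall
    ((isClosed_le continuous_const continuous_norm).inter
      (isClosed_le continuous_norm continuous_const))
    (hG.comp (by fun_prop) hin)
    (hN.comp (ContinuousOn.prodMk (by fun_prop) (ContinuousOn.smul (ContinuousOn.inv₀ (by fun_prop)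
      (fun b hb => by have := hb.1; intro h0; rw [h0] at this; norm_num at this))
      continuousOn_id)) hout)
    (fun b hb hb' => by
      have h12 : ‖b‖ = 1 / 2 := le_antisymm (by simpa using hb) hb'.1
      have := hN1 (‖b‖⁻¹ • b) (hout hb').2
      rw [h12] at this ⊢
      norm_num at this ⊢
      exact this.symm)
  have hcover : ∀ b ∈ closedBall (0 : E) 1,
      b ∈ closedBall (0 : E) (1 / 2) ∨ b ∈ {b : E | 1 / 2 ≤ ‖b‖ ∧ ‖b‖ ≤ 1} := fun b hb => by
    rcases le_total ‖b‖ (1 / 2) with h | h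
    · exact Or.inl (by simpa using h)
    · exact Or.inr ⟨h, by simpa using hb⟩
  refine ⟨F, hF.mono hcover, fun b hb => ?_, fun b hb => ?_⟩
  · rcases hcover b hb with h | h
    · rw [hF1 h]; exact hGU (hin h)
    · rw [hF2 h]; exact hNU (hout h)
  · have h1 : ‖b‖ = 1 := by simpa using hb
    rw [hF2 ⟨by rw [h1]; norm_num, h1.le⟩]
    simp [h1, hN0 b hb]

/-- A deformation of the unit sphere of `ℝ × E` inside `(ℝ × E) \ {0}`, starting at the identity
and ending with a map that sends everything outside the open top face to `(-1, 0)`. -/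
noncomputable def sphereDeformation (q : ℝ × ℝ × E) : ℝ × E :=
  ((1 - q.1) * q.2.1 + q.1 * ((1 - ‖q.2.2‖) * (1 + q.2.1) - 1),
    ((1 - q.1) + q.1 * ((1 - ‖q.2.2‖) * (1 + q.2.1) / 2)) • q.2.2)

theorem continuous_sphereDeformation : Continuous (sphereDeformation (E := E)) := by
  unfold sphereDeformation
  fun_prop

theorem sphereDeformation_ne_zero {s t : ℝ} {b : E} (hs : s ∈ Icc (0 : ℝ) 1)
    (htb : (t, b) ∈ sphere (0 : ℝ × E) 1) : sphereDeformation (s, t, b) ≠ 0 := by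
  intro h0
  have h1 : max |t| ‖b‖ = 1 := by simpa [Prod.norm_def] using htb
  have ht : |t| ≤ 1 := h1 ▸ le_max_left _ _
  have hb : ‖b‖ ≤ 1 := h1 ▸ le_max_right _ _
  obtain ⟨ht1, ht2⟩ := abs_le.1 ht
  simp only [sphereDeformation, Prod.mk_eq_zero, smul_eq_zero] at h0
  obtain ⟨hfst, hsnd | hsnd⟩ := h0
  · have hu : 0 ≤ (1 - ‖b‖) * (1 + t) := mul_nonneg (by linarith) (by linarith)
    have hsu : 0 ≤ s * ((1 - ‖b‖) * (1 + t) / 2) := mul_nonneg hs.1 (by linarith)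
    have hs1 : s = 1 := by linarith [hs.2]
    subst hs1
    linarith
  · subst hsnd
    have : |t| = 1 := by simpa using h1
    rcases (abs_eq zero_le_one).1 this with rfl | rfl
    · norm_num at hfst
    · norm_num at hfst
      linarith

/-- Free spheres can be filled as soon as based spheres can. -/
theorem BallLoopsContract.sphereExtends {V U : Set X} (hVU : V ⊆ U)
    (h : BallLoopsContract E V U) : SphereExtends (ℝ × E) V U := by
  intro f hf hfV
  set d : ℝ × ℝ × E → ℝ × E := fun q => ‖sphereDeformation q‖⁻¹ • sphereDeformation q with hd
  have hdc : ContinuousOn d (Icc 0 1 ×ˢ sphere 0 1) :=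
    ContinuousOn.smul (ContinuousOn.inv₀ continuous_sphereDeformation.norm.continuousOn
      fun q hq => norm_ne_zero_iff.2 (sphereDeformation_ne_zero hq.1 hq.2))
      continuous_sphereDeformation.continuousOn
  have hdm : MapsTo d (Icc 0 1 ×ˢ sphere 0 1) (sphere 0 1) := fun q hq => by
    have := norm_ne_zero_iff.2 (sphereDeformation_ne_zero hq.1 hq.2)
    rw [mem_sphere_zero_iff_norm, hd, norm_smul, norm_inv, norm_norm, inv_mul_cancel₀ this]
  have hd0 : ∀ b ∈ sphere (0 : ℝ × E) 1, d (0, b) = b := fun b hb => by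
    have : max |b.1| ‖b.2‖ = 1 := by simpa [Prod.norm_def] using hb
    simp [hd, sphereDeformation, Prod.norm_def, this]
  have hdside : ∀ t : ℝ, ∀ b ∈ sphere (0 : E) 1, d (1, t, b) = (-1, 0) := fun t b hb => by
    have : ‖b‖ = 1 := by simpa using hb
    simp [hd, sphereDeformation, this, Prod.norm_def]
  have hdbot : ∀ b : E, d (1, -1, b) = (-1, 0) := fun b => by
    simp [hd, sphereDeformation, Prod.norm_def]
  have htop : MapsTo (fun b : E => ((1 : ℝ), (1 : ℝ), b)) (closedBall 0 1)
      (Icc 0 1 ×ˢ sphere 0 1) := fun b hb => by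
    refine ⟨by simp, ?_⟩
    have : ‖b‖ ≤ 1 := by simpa using hb
    simp [Prod.norm_def, this]
  have hbase : ((-1 : ℝ), (0 : E)) ∈ sphere (0 : ℝ × E) 1 := by simp [Prod.norm_def]
  obtain ⟨K, hK, hKU, hK1, hK2, hK3⟩ := h (f (-1, 0)) (hfV hbase) (fun b => f (d (1, 1, b)))
    (hf.comp (hdc.comp (by fun_prop) htop) (hdm.comp htop)) (hfV.comp (hdm.comp htop))
    (fun b hb => by rw [hdside 1 b hb])
  rw [← closedBall_real_prod] at hK hKU
  refine exists_extension_of_homotopy (N := f ∘ d) (G := K) (hf.comp hdc hdm)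
    ((hfV.mono_right hVU).comp hdm) (fun b hb => by simp [hd0 b hb]) ?_ hK hKU
  rintro ⟨t, b⟩ htb
  have h1 : max |t| ‖b‖ = 1 := by simpa [Prod.norm_def] using htb
  have hb : b ∈ closedBall (0 : E) 1 := by simpa using h1 ▸ le_max_right |t| ‖b‖
  rcases max_choice |t| ‖b‖ with h' | h'
  · rcases (abs_eq zero_le_one).1 (h'.symm.trans h1) with rfl | rfl
    · rw [hK1 b hb, Function.comp_apply]
    · rw [hK2 b hb, Function.comp_apply, hdbot]
  · have hbs : b ∈ sphere (0 : E) 1 := by simpa using h'.symm.trans h1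
    rw [hK3 t (abs_le.1 (h1 ▸ le_max_left |t| ‖b‖)) b hbs, Function.comp_apply, hdside t b hbs]

end SphereExtension

section SphereLocallyConnected

open Metric

/-- Local `n`-connectedness phrased in terms of filling maps from spheres of dimension at most
`n`. -/
def SphereLocallyConnected (n : ℕ) (X : Type*) [TopologicalSpace X] : Prop :=
  ∀ (x : X) (U : Set X), IsOpen U → x ∈ U →
    ∃ V : Set X, IsOpen V ∧ x ∈ V ∧ V ⊆ U ∧ ∀ k ≤ n, SphereExtends (Fin (k + 1) → ℝ) V U

variable {X Y : Type*} [TopologicalSpace X] [TopologicalSpace Y]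

theorem SphereLocallyConnected.of_homeomorph {n : ℕ} (h : SphereLocallyConnected n X)
    (e : Y ≃ₜ X) : SphereLocallyConnected n Y := fun y U hU hy => by
  obtain ⟨V, hV, hyV, hVU, hext⟩ := h (e y) (e.symm ⁻¹' U) (hU.preimage e.symm.continuous)
    (by simpa using hy)
  have he : e ⁻¹' (e.symm ⁻¹' U) = U := by rw [← preimage_comp]; simp
  refine ⟨e ⁻¹' V, hV.preimage e.continuous, hyV, he ▸ preimage_mono hVU, fun k hk => ?_⟩
  exact he ▸ (hext k hk).preimage_homeomorph e

/-- Nullhomotopies of based cubes give nullhomotopies of maps on sup-norm balls that are constant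
on the sphere. -/
theorem ballLoopsContract_of_nullHomotopicIn {k : ℕ} {V U : Set X}
    (h : ∀ y ∈ V, ∀ p : GenLoop (Fin k) X y, (∀ t, p t ∈ V) → GenLoop.NullHomotopicIn p U) :
    BallLoopsContract (Fin k → ℝ) V U := by
  intro y hy p hp hpV hpy
  let c : (Fin k → I) → (Fin k → ℝ) := fun t i => 2 * (t i : ℝ) - 1
  let e : (Fin k → ℝ) → (Fin k → I) := fun b i => projIcc 0 1 zero_le_one ((b i + 1) / 2)
  have hc : Continuous c := by fun_prop
  have he : Continuous e :=
    continuous_pi fun i => continuous_projIcc.comp (by fun_prop)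
  have hcb : ∀ t, c t ∈ closedBall (0 : Fin k → ℝ) 1 := fun t => by
    rw [mem_closedBall_zero_iff, pi_norm_le_iff_of_nonneg zero_le_one]
    intro i
    have h1 := (t i).2.1
    have h2 := (t i).2.2
    exact abs_le.2 ⟨by simp only [c]; linarith, by simp only [c]; linarith⟩
  have hcs : ∀ t ∈ Cube.boundary (Fin k), c t ∈ sphere (0 : Fin k → ℝ) 1 := by
    rintro t ⟨i, hi⟩
    rw [mem_sphere_zero_iff_norm]
    refine le_antisymm (by simpa using hcb t) ?_
    refine le_trans (le_of_eq ?_) (norm_le_pi_norm (c t) i)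
    rcases hi with hi | hi <;> norm_num [c, hi]
  have hce : ∀ b ∈ closedBall (0 : Fin k → ℝ) 1, c (e b) = b := fun b hb => by
    rw [mem_closedBall_zero_iff, pi_norm_le_iff_of_nonneg zero_le_one] at hb
    ext i
    obtain ⟨h1, h2⟩ := abs_le.1 (hb i)
    simp only [c, e]
    rw [projIcc_of_mem zero_le_one (x := (b i + 1) / 2) ⟨by linarith, by linarith⟩]
    ring
  have hes : ∀ b ∈ sphere (0 : Fin k → ℝ) 1, e b ∈ Cube.boundary (Fin k) := fun b hb => by
    rw [mem_sphere_zero_iff_norm] at hb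
    have : ∃ i, 1 ≤ ‖b i‖ := by
      by_contra! hlt
      exact absurd hb ((pi_norm_lt_iff zero_lt_one).2 hlt).ne
    obtain ⟨i, hi⟩ := this
    refine ⟨i, ?_⟩
    rcases le_abs.1 hi with h1 | h1
    · exact Or.inr (projIcc_of_right_le zero_le_one (by linarith))
    · exact Or.inl (projIcc_of_le_left zero_le_one (by linarith))
  obtain ⟨H, hH⟩ := h y hy
    ⟨⟨p ∘ c, hp.comp_continuous hc hcb⟩, fun t ht => hpy _ (hcs t ht)⟩ fun t => hpV (hcb t)
  refine ⟨fun q => H (projIcc 0 1 zero_le_one ((1 - q.1) / 2), e q.2), ?_, fun q _ => hH _,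
    fun b hb => ?_, fun b hb => ?_, fun t ht b hb => ?_⟩
  · exact (H.continuous.comp ((continuous_projIcc.comp (by fun_prop)).prodMk
      (he.comp continuous_snd))).continuousOn
  · have : projIcc (0 : ℝ) 1 zero_le_one ((1 - 1) / 2) = 0 :=
      projIcc_of_le_left zero_le_one (by norm_num)
    simp only [this, H.apply_zero]
    exact congrArg p (hce b hb)
  · have : projIcc (0 : ℝ) 1 zero_le_one ((1 - -1) / 2) = 1 :=
      projIcc_of_right_le zero_le_one (by norm_num)
    simp only [this, H.apply_one]
    rfl
  · refine (H.eq_fst _ (hes b hb)).trans ?_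
    exact (congrArg p (hce b (sphere_subset_closedBall hb))).trans (hpy b hb)

theorem LocallyNConnected.sphereLocallyConnected {n : ℕ} (h : LocallyNConnected n X) :
    SphereLocallyConnected n X := fun x U hU hx => by
  obtain ⟨V, hV, hxV, hVU, hnull⟩ := h x U hU hx
  exact ⟨V, hV, hxV, hVU, fun k hk => sphereExtends_fin_succ_iff.2
    ((ballLoopsContract_of_nullHomotopicIn (hnull k hk)).sphereExtends hVU)⟩

/-- Points of a space in which `0`-spheres can be filled locally have neighbourhoods whose points
are all joined to them. -/
theorem SphereLocallyConnected.eventually_joined (h : SphereLocallyConnected 0 X) (x : X) :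
    ∀ᶠ y in 𝓝 x, Joined x y := by
  obtain ⟨V, hV, hxV, -, hext⟩ := h x univ isOpen_univ (mem_univ x)
  filter_upwards [hV.mem_nhds hxV] with y hy
  obtain ⟨f, hf, hfx, hfy⟩ := exists_continuousOn_union (s := {b : Fin 1 → ℝ | b 0 ≤ -1})
    (t := {b : Fin 1 → ℝ | 1 ≤ b 0}) (f := fun _ => x) (g := fun _ => y)
    (isClosed_le (by fun_prop) (by fun_prop)) (isClosed_le (by fun_prop) (by fun_prop))
    continuousOn_const continuousOn_const
    (fun b (h1 : b 0 ≤ -1) (h2 : 1 ≤ b 0) => by linarith)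
  have hcover : ∀ b ∈ sphere (0 : Fin 1 → ℝ) 1,
      b ∈ {b : Fin 1 → ℝ | b 0 ≤ -1} ∨ b ∈ {b : Fin 1 → ℝ | 1 ≤ b 0} := fun b hb => by
    have hb1 : |b 0| = 1 := by simpa [Pi.norm_def] using hb
    rcases (abs_eq zero_le_one).1 hb1 with h1 | h1
    · exact Or.inr h1.ge
    · exact Or.inl h1.le
  obtain ⟨F, hF, -, hFf⟩ := hext 0 le_rfl f (hf.mono hcover) fun b hb => by
    rcases hcover b hb with h1 | h1
    · rw [hfx h1]; exact hxV
    · rw [hfy h1]; exact hy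
  have hFx : F (fun _ => -1) = x := by
    rw [hFf (by simp [Pi.norm_def]), hfx (by simp)]
  have hFy : F (fun _ => 1) = y := by
    rw [hFf (by simp [Pi.norm_def]), hfy (by simp)]
  refine ⟨⟨⟨fun t => F fun _ => 2 * (t : ℝ) - 1, hF.comp_continuous (by fun_prop) fun t => ?_⟩,
    ?_, ?_⟩⟩
  · rw [mem_closedBall_zero_iff, pi_norm_le_iff_of_nonneg zero_le_one]
    exact fun _ => abs_le.2 ⟨by linarith [t.2.1], by linarith [t.2.2]⟩
  · simpa using hFx
  · norm_num [hFy]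

end SphereLocallyConnected

section PathSpace

open Metric

/-- A cylinder over the unit ball can be filled once its lateral surface, bottom and top are
prescribed. -/
theorem SphereExtends.exists_cylinder {E X : Type*} [NormedAddCommGroup E] [TopologicalSpace X]
    {V U : Set X} (h : SphereExtends (ℝ × E) V U) {a c : ℝ} (hac : a < c) {β τ : E → X}
    {g : ℝ × E → X} (hβ : ContinuousOn β (closedBall 0 1)) (hβV : MapsTo β (closedBall 0 1) V)
    (hτ : ContinuousOn τ (closedBall 0 1)) (hτV : MapsTo τ (closedBall 0 1) V)
    (hg : ContinuousOn g (Icc a c ×ˢ sphere 0 1)) (hgV : MapsTo g (Icc a c ×ˢ sphere 0 1) V)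
    (hβg : ∀ b ∈ sphere (0 : E) 1, β b = g (a, b)) (hτg : ∀ b ∈ sphere (0 : E) 1, τ b = g (c, b)) :
    ∃ G : ℝ × E → X, ContinuousOn G (Icc a c ×ˢ closedBall 0 1) ∧
      MapsTo G (Icc a c ×ˢ closedBall 0 1) U ∧ EqOn G g (Icc a c ×ˢ sphere 0 1) ∧
      (∀ b ∈ closedBall (0 : E) 1, G (a, b) = β b) ∧
      (∀ b ∈ closedBall (0 : E) 1, G (c, b) = τ b) := by
  have hca : 0 < c - a := sub_pos.2 hac
  let u : ℝ → ℝ := fun s => a + (s + 1) / 2 * (c - a)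
  let v : ℝ → ℝ := fun t => 2 * ((t - a) / (c - a)) - 1
  have huv : ∀ t, u (v t) = t := fun t => by simp only [u, v]; field_simp; ring
  have hum : MapsTo u (Icc (-1) 1) (Icc a c) := fun s hs => by
    have h0 : 0 ≤ (s + 1) / 2 := by linarith [hs.1]
    have h1 : (s + 1) / 2 ≤ 1 := by linarith [hs.2]
    exact ⟨by simp only [u]; nlinarith, by simp only [u]; nlinarith⟩
  have hvm : MapsTo v (Icc a c) (Icc (-1) 1) := fun t ht => by
    have h0 : 0 ≤ (t - a) / (c - a) := div_nonneg (by linarith [ht.1]) hca.le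
    have h1 : (t - a) / (c - a) ≤ 1 := (div_le_one hca).2 (by linarith [ht.2])
    exact ⟨by simp only [v]; linarith, by simp only [v]; linarith⟩
  have hu0 : u (-1) = a := by simp [u]
  have hu1 : u 1 = c := by simp [u]
  have hv0 : v a = -1 := by simp [v]
  have hv1 : v c = 1 := by simp only [v]; rw [div_self hca.ne']; norm_num
  obtain ⟨f₁, hf₁, hf₁b, hf₁t⟩ := exists_continuousOn_union
    (s := ({-1} : Set ℝ) ×ˢ closedBall (0 : E) 1) (t := ({1} : Set ℝ) ×ˢ closedBall (0 : E) 1)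
    (f := fun q => β q.2) (g := fun q => τ q.2)
    (isClosed_singleton.prod isClosed_closedBall) (isClosed_singleton.prod isClosed_closedBall)
    (hβ.comp continuousOn_snd fun q hq => hq.2) (hτ.comp continuousOn_snd fun q hq => hq.2)
    (fun q hq hq' => by
      have h1 : q.1 = -1 := hq.1
      have h2 : q.1 = 1 := hq'.1
      linarith)
  have hside : MapsTo (fun q : ℝ × E => (u q.1, q.2)) (Icc (-1) 1 ×ˢ sphere 0 1)
      (Icc a c ×ˢ sphere 0 1) := fun q hq => ⟨hum hq.1, hq.2⟩
  obtain ⟨f₂, hf₂, hf₂e, hf₂s⟩ := exists_continuousOn_union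
    (t := Icc (-1 : ℝ) 1 ×ˢ sphere (0 : E) 1)
    (g := fun q => g (u q.1, q.2))
    ((isClosed_singleton.prod isClosed_closedBall).union
      (isClosed_singleton.prod isClosed_closedBall)) (isClosed_Icc.prod isClosed_sphere) hf₁
    (hg.comp (by fun_prop) hside)
    (by
      rintro ⟨s, b⟩ (hq | hq) hq'
      · obtain rfl : s = -1 := hq.1
        simpa only [hf₁b hq, hu0] using hβg b hq'.2
      · obtain rfl : s = 1 := hq.1
        simpa only [hf₁t hq, hu1] using hτg b hq'.2)
  have hcover : ∀ q ∈ sphere (0 : ℝ × E) 1,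
      q ∈ (({-1} : Set ℝ) ×ˢ closedBall (0 : E) 1 ∪ ({1} : Set ℝ) ×ˢ closedBall (0 : E) 1) ∪
        Icc (-1 : ℝ) 1 ×ˢ sphere (0 : E) 1 := by
    rintro ⟨s, b⟩ hq
    have h1 : max |s| ‖b‖ = 1 := by simpa [Prod.norm_def] using hq
    have hb : b ∈ closedBall (0 : E) 1 := by simpa using h1 ▸ le_max_right |s| ‖b‖
    rcases max_choice |s| ‖b‖ with h' | h'
    · rcases (abs_eq zero_le_one).1 (h'.symm.trans h1) with rfl | rfl
      · exact Or.inl (Or.inr ⟨rfl, hb⟩)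
      · exact Or.inl (Or.inl ⟨rfl, hb⟩)
    · exact Or.inr ⟨abs_le.1 (h1 ▸ le_max_left |s| ‖b‖), by simpa using h'.symm.trans h1⟩
  obtain ⟨G, hG, hGU, hGf⟩ := h f₂ (hf₂.mono hcover) fun q hq => by
    rcases hcover q hq with (h1 | h1) | h1
    · rw [hf₂e (Or.inl h1), hf₁b h1]; exact hβV h1.2
    · rw [hf₂e (Or.inr h1), hf₁t h1]; exact hτV h1.2
    · rw [hf₂s h1]; exact hgV (hside h1)
  rw [closedBall_real_prod] at hG hGU
  have hvball : MapsTo (fun q : ℝ × E => (v q.1, q.2)) (Icc a c ×ˢ closedBall 0 1)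
      (Icc (-1) 1 ×ˢ closedBall 0 1) := fun q hq => ⟨hvm hq.1, hq.2⟩
  refine ⟨fun q => G (v q.1, q.2), hG.comp (by fun_prop) hvball, hGU.comp hvball, ?_, ?_, ?_⟩
  · rintro ⟨t, b⟩ ⟨ht, hb⟩
    have hb1 : ‖b‖ = 1 := by simpa using hb
    have hvt : |v t| ≤ 1 := abs_le.2 (hvm ht)
    simp only
    have hvb : (v t, b) ∈ Icc (-1 : ℝ) 1 ×ˢ sphere (0 : E) 1 := ⟨hvm ht, hb⟩
    rw [hGf (by simp [Prod.norm_def, hb1, hvt]), hf₂s hvb]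
    simp only [huv]
  · intro b hb
    have hb1 : ‖b‖ ≤ 1 := by simpa using hb
    simp only [hv0]
    have hq : ((-1 : ℝ), b) ∈ ({-1} : Set ℝ) ×ˢ closedBall (0 : E) 1 := ⟨rfl, hb⟩
    rw [hGf (by simp [Prod.norm_def, hb1]), hf₂e (Or.inl hq), hf₁b hq]
  · intro b hb
    have hb1 : ‖b‖ ≤ 1 := by simpa using hb
    simp only [hv1]
    have hq : ((1 : ℝ), b) ∈ ({1} : Set ℝ) ×ˢ closedBall (0 : E) 1 := ⟨rfl, hb⟩
    rw [hGf (by simp [Prod.norm_def, hb1]), hf₂e (Or.inr hq), hf₁t hq]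

variable {X : Type*} [PseudoMetricSpace X]

/-- Local fillability of spheres is uniform along compact sets. -/
theorem SphereLocallyConnected.exists_uniform {n : ℕ} (h : SphereLocallyConnected n X)
    {K : Set X} (hK : IsCompact K) {ε : ℝ} (hε : 0 < ε) :
    ∃ δ > 0, δ ≤ ε ∧ ∀ z ∈ K, ∀ k ≤ n,
      SphereExtends (Fin (k + 1) → ℝ) (ball z δ) (ball z ε) := by
  refine hK.induction_on (p := fun S => ∃ δ > 0, δ ≤ ε ∧ ∀ z ∈ S, ∀ k ≤ n,
    SphereExtends (Fin (k + 1) → ℝ) (ball z δ) (ball z ε)) ⟨ε, hε, le_rfl, by simp⟩ ?_ ?_ ?_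
  · rintro S T hST ⟨δ, hδ, hδε, hT⟩
    exact ⟨δ, hδ, hδε, fun z hz => hT z (hST hz)⟩
  · rintro S T ⟨δ, hδ, hδε, hS⟩ ⟨δ', hδ', hδε', hT⟩
    refine ⟨min δ δ', lt_min hδ hδ', (min_le_left _ _).trans hδε, ?_⟩
    rintro z (hz | hz) k hk
    · exact (hS z hz k hk).mono (ball_subset_ball (min_le_left _ _)) subset_rfl
    · exact (hT z hz k hk).mono (ball_subset_ball (min_le_right _ _)) subset_rfl
  · intro z _
    obtain ⟨V, hV, hzV, -, hext⟩ := h z (ball z (ε / 2)) isOpen_ball (mem_ball_self (half_pos hε))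
    obtain ⟨r, hr, hrV⟩ := Metric.isOpen_iff.1 hV z hzV
    have hδ : 0 < min (r / 2) (ε / 2) := lt_min (half_pos hr) (half_pos hε)
    refine ⟨ball z (min (r / 2) (ε / 2)), mem_nhdsWithin_of_mem_nhds (ball_mem_nhds z hδ),
      min (r / 2) (ε / 2), hδ, (min_le_right _ _).trans (half_le_self hε.le), fun w hw k hk => ?_⟩
    have hwr : dist w z < r / 2 := hw.trans_le (min_le_left _ _)
    have hwε : dist z w < ε / 2 := dist_comm w z ▸ hw.trans_le (min_le_right _ _)
    refine (hext k hk).mono (Subset.trans (ball_subset_ball' ?_) hrV) (ball_subset_ball' ?_)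
    · linarith [min_le_left (r / 2) (ε / 2)]
    · linarith

/-- A sphere of paths close to `γ` can be filled by a ball of paths close to `γ`, provided that
spheres close to each point of `γ` can be filled. -/
theorem exists_filling_near_path {E : Type*} [NormedAddCommGroup E] {γ : ℝ → X}
    (hγ : Continuous γ) {δ η ε : ℝ} (hδη : δ ≤ η) (hη : 0 < η) (hε : 0 < ε)
    (h₁ : ∀ t ∈ Icc (0 : ℝ) 1, SphereExtends E (ball (γ t) δ) (ball (γ t) η))
    (h₂ : ∀ t ∈ Icc (0 : ℝ) 1, SphereExtends (ℝ × E) (ball (γ t) (2 * η)) (ball (γ t) ε))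
    {g : ℝ × E → X} (hg : ContinuousOn g (Icc 0 1 ×ˢ sphere 0 1))
    (hgγ : ∀ t ∈ Icc (0 : ℝ) 1, ∀ b ∈ sphere (0 : E) 1, dist (g (t, b)) (γ t) < δ)
    (hg₀ : ∀ b ∈ sphere (0 : E) 1, g (0, b) = γ 0) (hg₁ : ∀ b ∈ sphere (0 : E) 1, g (1, b) = γ 1) :
    ∃ G : ℝ × E → X, ContinuousOn G (Icc 0 1 ×ˢ closedBall 0 1) ∧
      (∀ t ∈ Icc (0 : ℝ) 1, ∀ b ∈ closedBall (0 : E) 1, dist (G (t, b)) (γ t) < 2 * ε) ∧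
      EqOn G g (Icc 0 1 ×ˢ sphere 0 1) ∧
      (∀ b ∈ closedBall (0 : E) 1, G (0, b) = γ 0) ∧
      (∀ b ∈ closedBall (0 : E) 1, G (1, b) = γ 1) := by
  have hslice : ∀ t : ℝ, ∃ β : E → X, t ∈ Icc (0 : ℝ) 1 → ContinuousOn β (closedBall 0 1) ∧
      MapsTo β (closedBall 0 1) (ball (γ t) η) ∧ (∀ b ∈ sphere (0 : E) 1, β b = g (t, b)) ∧
      (t = 0 ∨ t = 1 → ∀ b, β b = γ t) := fun t => by
    by_cases ht : t ∈ Icc (0 : ℝ) 1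
    · by_cases ht' : t = 0 ∨ t = 1
      · refine ⟨fun _ => γ t, fun _ => ⟨continuousOn_const, fun _ _ => mem_ball_self hη, ?_,
          fun _ _ => rfl⟩⟩
        rcases ht' with rfl | rfl
        · exact fun b hb => (hg₀ b hb).symm
        · exact fun b hb => (hg₁ b hb).symm
      · have hm : MapsTo (fun b : E => (t, b)) (sphere 0 1) (Icc 0 1 ×ˢ sphere 0 1) :=
          fun b hb => ⟨ht, hb⟩
        obtain ⟨β, hβ, hβm, hβg⟩ := h₁ t ht (fun b => g (t, b)) (hg.comp (by fun_prop) hm)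
          (hgγ t ht)
        exact ⟨β, fun _ => ⟨hβ, hβm, hβg, fun h => absurd h ht'⟩⟩
    · exact ⟨fun _ => γ t, fun h => absurd h ht⟩
  choose β hβ using hslice
  obtain ⟨r, hr, hrγ⟩ := Metric.uniformContinuousOn_iff.1
    (isCompact_Icc.uniformContinuousOn_of_continuous hγ.continuousOn) (min η ε) (lt_min hη hε)
  obtain ⟨N, hN⟩ := exists_nat_one_div_lt hr
  have hN0 : (0 : ℝ) < N + 1 := by positivity
  have key : ∀ i : ℕ, i ≤ N + 1 → ∃ G : ℝ × E → X,
      ContinuousOn G (Icc 0 (i / (N + 1) : ℝ) ×ˢ closedBall 0 1) ∧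
      (∀ t ∈ Icc (0 : ℝ) (i / (N + 1)), ∀ b ∈ closedBall (0 : E) 1,
        dist (G (t, b)) (γ t) < 2 * ε) ∧
      EqOn G g (Icc 0 (i / (N + 1) : ℝ) ×ˢ sphere 0 1) ∧
      (∀ b ∈ closedBall (0 : E) 1, G (0, b) = γ 0) ∧
      (∀ b ∈ closedBall (0 : E) 1, G (i / (N + 1), b) = β (i / (N + 1)) b) := by
    intro i
    induction i with
    | zero =>
      intro _
      refine ⟨fun _ => γ 0, continuousOn_const, fun t ht b _ => ?_, ?_, fun _ _ => rfl,
        fun b _ => ?_⟩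
      · obtain rfl : t = 0 := le_antisymm (by simpa using ht.2) ht.1
        simpa using hε
      · rintro ⟨t, b⟩ ⟨ht, hb⟩
        obtain rfl : t = 0 := le_antisymm (by simpa using ht.2) ht.1
        exact (hg₀ b hb).symm
      · simp [(hβ 0 (by simp)).2.2.2 (Or.inl rfl) b]
    | succ i ih =>
      intro hi
      obtain ⟨G, hG, hGγ, hGg, hG₀, hGi⟩ := ih (by omega)
      set a : ℝ := i / (N + 1) with ha
      set c : ℝ := (i + 1 : ℕ) / (N + 1) with hc
      have hca : c = a + 1 / (N + 1) := by rw [ha, hc]; push_cast; ring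
      have hac : a < c := by rw [hca]; linarith [one_div_pos.2 hN0]
      have ha0 : 0 ≤ a := by positivity
      have hc1 : c ≤ 1 := (div_le_one hN0).2 (by exact_mod_cast hi)
      have hsub : Icc a c ⊆ Icc 0 1 := Icc_subset_Icc ha0 hc1
      have haI : a ∈ Icc (0 : ℝ) 1 := hsub (left_mem_Icc.2 hac.le)
      have hcI : c ∈ Icc (0 : ℝ) 1 := hsub (right_mem_Icc.2 hac.le)
      have hosc : ∀ t ∈ Icc a c, dist (γ t) (γ a) < min η ε := fun t ht =>
        hrγ t (hsub ht) a haI (by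
          rw [Real.dist_eq, abs_of_nonneg (by linarith [ht.1])]
          linarith [ht.2])
      have hoscη : ∀ t ∈ Icc a c, dist (γ t) (γ a) < η := fun t ht =>
        (hosc t ht).trans_le (min_le_left _ _)
      have hoscε : ∀ t ∈ Icc a c, dist (γ t) (γ a) < ε := fun t ht =>
        (hosc t ht).trans_le (min_le_right _ _)
      obtain ⟨hβa, hβaγ, hβag, -⟩ := hβ a haI
      obtain ⟨hβc, hβcγ, hβcg, -⟩ := hβ c hcI
      obtain ⟨G', hG', hG'U, hG'g, hG'a, hG'c⟩ := (h₂ a haI).exists_cylinder hac hβa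
        (hβaγ.mono_right (ball_subset_ball (by linarith))) hβc
        (fun b hb => by
          have h1 := mem_ball.1 (hβcγ hb)
          rw [mem_ball]
          linarith [dist_triangle (β c b) (γ c) (γ a), hoscη c (right_mem_Icc.2 hac.le)])
        (hg.mono (prod_mono hsub subset_rfl))
        (fun q hq => by
          have h1 := hgγ q.1 (hsub hq.1) q.2 hq.2
          rw [mem_ball]
          linarith [dist_triangle (g q) (γ q.1) (γ a), hoscη q.1 hq.1])
        hβag hβcg
      obtain ⟨F, hF, hFG, hFG'⟩ := exists_continuousOn_union
        (isClosed_Icc.prod isClosed_closedBall) (isClosed_Icc.prod isClosed_closedBall) hG hG'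
        (by
          rintro ⟨t, b⟩ hq hq'
          obtain rfl : t = a := le_antisymm hq.1.2 hq'.1.1
          rw [hGi b hq.2, hG'a b hq.2])
      rw [← union_prod, Icc_union_Icc_eq_Icc ha0 hac.le] at hF
      refine ⟨F, hF, fun t ht b hb => ?_, ?_, fun b hb => ?_, fun b hb => ?_⟩
      · rcases le_total t a with hta | hta
        · rw [hFG ⟨⟨ht.1, hta⟩, hb⟩]
          exact hGγ t ⟨ht.1, hta⟩ b hb
        · rw [hFG' ⟨⟨hta, ht.2⟩, hb⟩]
          have h1 : dist (G' (t, b)) (γ a) < ε := hG'U ⟨⟨hta, ht.2⟩, hb⟩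
          have h2 := hoscε t ⟨hta, ht.2⟩
          linarith [dist_triangle_right (G' (t, b)) (γ t) (γ a)]
      · rintro ⟨t, b⟩ ⟨ht, hb⟩
        have hb' := sphere_subset_closedBall hb
        rcases le_total t a with hta | hta
        · rw [hFG ⟨⟨ht.1, hta⟩, hb'⟩]
          exact hGg ⟨⟨ht.1, hta⟩, hb⟩
        · rw [hFG' ⟨⟨hta, ht.2⟩, hb'⟩]
          exact hG'g ⟨⟨hta, ht.2⟩, hb⟩
      · rw [hFG ⟨⟨le_rfl, ha0⟩, hb⟩, hG₀ b hb]
      · rw [hFG' ⟨⟨hac.le, le_rfl⟩, hb⟩, hG'c b hb]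
  obtain ⟨G, hG, hGγ, hGg, hG₀, hG₁⟩ := key (N + 1) le_rfl
  have hone : ((N + 1 : ℕ) : ℝ) / (N + 1) = 1 := by push_cast; exact div_self hN0.ne'
  rw [hone] at hG hGγ hGg hG₁
  exact ⟨G, hG, hGγ, hGg, hG₀, fun b hb => by
    rw [hG₁ b hb, (hβ 1 (by simp)).2.2.2 (Or.inr rfl) b]⟩

/-- Path spaces of locally `(n + 1)`-connected spaces are locally `n`-connected. -/
theorem SphereLocallyConnected.path {n : ℕ} (h : SphereLocallyConnected (n + 1) X) (x y : X) :
    SphereLocallyConnected n (Path x y) := by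
  have hind : Topology.IsInducing fun γ : Path x y => (γ : C(I, X)) := ⟨rfl⟩
  intro γ U hU hγU
  have hnhds : (𝓝 γ).HasBasis (fun ε : ℝ => 0 < ε) fun ε => {γ' | dist (γ' : C(I, X)) γ < ε} := by
    rw [hind.nhds_eq_comap]
    exact nhds_basis_ball.comap _
  obtain ⟨ε, hε, hεU⟩ := hnhds.mem_iff.1 (hU.mem_nhds hγU)
  have hK : IsCompact (range γ) := isCompact_range γ.continuous
  obtain ⟨η, hη, hηε, hη_ext⟩ := h.exists_uniform hK (show 0 < ε / 4 by linarith)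
  obtain ⟨δ, hδ, hδη, hδ_ext⟩ := h.exists_uniform hK (half_pos hη)
  refine ⟨{γ' | dist (γ' : C(I, X)) γ < δ},
    isOpen_ball.preimage hind.continuous, by simpa using hδ, fun γ' hγ' => hεU ?_,
    fun k hk f hf hfV => ?_⟩
  · exact lt_trans (mem_ofPred.1 hγ') (by linarith)
  have hproj : Continuous (projIcc (0 : ℝ) 1 zero_le_one) := continuous_projIcc
  obtain ⟨G, hG, hGγ, hGg, hG₀, hG₁⟩ := exists_filling_near_path
    (E := Fin (k + 1) → ℝ) (γ := fun t => γ (projIcc 0 1 zero_le_one t))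
    (γ.continuous.comp hproj) hδη (half_pos hη) (show 0 < ε / 4 by linarith)
    (fun t _ => hδ_ext _ (mem_range_self _) k (by omega))
    (fun t _ => sphereExtends_fin_succ_iff.1 (by
      rw [mul_div_cancel₀ _ two_ne_zero]
      exact hη_ext _ (mem_range_self _) (k + 1) (by omega)))
    (g := fun q => f q.2 (projIcc 0 1 zero_le_one q.1))
    (ContinuousOn.eval (hf.comp continuousOn_snd fun q hq => hq.2)
      (hproj.comp continuous_fst).continuousOn)
    (fun t _ b hb => (ContinuousMap.dist_apply_le_dist (f := (f b : C(I, X))) (g := γ) _).trans_lt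
      (hfV hb))
    (by simp) (by simp)
  simp only [projIcc_left, projIcc_right] at hG₀ hG₁
  have hGI : ∀ b ∈ closedBall (0 : Fin (k + 1) → ℝ) 1, Continuous fun t : I => G (t, b) :=
    fun b hb => hG.comp_continuous (by fun_prop) fun t => ⟨t.2, hb⟩
  classical
  let F : (Fin (k + 1) → ℝ) → Path x y := fun b =>
    if hb : b ∈ closedBall (0 : Fin (k + 1) → ℝ) 1 then
      ⟨⟨fun t => G (t, b), hGI b hb⟩, by simpa using hG₀ b hb, by simpa using hG₁ b hb⟩
    else γ
  have hF : ∀ b ∈ closedBall (0 : Fin (k + 1) → ℝ) 1, ∀ t : I, F b t = G (t, b) :=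
    fun b hb t => by simp only [F, dif_pos hb]; rfl
  refine ⟨F, ?_, fun b hb => hεU ?_, fun b hb => ?_⟩
  · rw [continuousOn_iff_continuous_domRestrict, ← Path.continuous_uncurry_iff]
    have : Continuous fun q : closedBall (0 : Fin (k + 1) → ℝ) 1 × I => G (q.2, q.1) :=
      hG.comp_continuous (by fun_prop) fun q => ⟨q.2.2, q.1.2⟩
    exact this.congr fun q => (hF q.1 q.1.2 q.2).symm
  · refine (ContinuousMap.dist_lt_iff hε).2 fun t => ?_
    have h1 := hGγ t t.2 b hb
    rw [projIcc_val] at h1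
    have h2 : dist (F b t) (γ t) < ε := by rw [hF b hb t]; linarith
    exact h2
  · ext t
    rw [hF b (sphere_subset_closedBall hb) t, hGg ⟨t.2, hb⟩]
    simp

end PathSpace

section LoopSpaces

/-- Iterated loop spaces of locally connected spaces are locally connected, with the degree
dropping by the number of loop coordinates. -/
theorem SphereLocallyConnected.genLoop {X : Type*} [MetricSpace X] {x : X} (m : ℕ) :
    ∀ (N : Type) [Fintype N], Fintype.card N = m → ∀ n : ℕ, SphereLocallyConnected (n + m) X →
      SphereLocallyConnected n (GenLoop N X x) := by
  classical
  induction m with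
  | zero =>
    intro N _ hN n h
    have : IsEmpty N := Fintype.card_eq_zero_iff.1 hN
    refine h.of_homeomorph
      { toFun := fun p => p default
        invFun := fun z => ⟨ContinuousMap.const _ z, fun _ hy => isEmptyElim hy.choose⟩
        left_inv := fun p => by ext t; rw [Subsingleton.elim t default]; rfl
        right_inv := fun z => rfl
        continuous_toFun := continuous_eval_const _
        continuous_invFun := ContinuousMap.continuous_const'.subtype_mk _ }
  | succ m ih =>
    intro N _ hN n h
    obtain ⟨i⟩ : Nonempty N := Fintype.card_pos_iff.1 (by omega)
    have hcard : Fintype.card { j // j ≠ i } = m := by simp [hN]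
    exact ((ih { j // j ≠ i } hcard (n + 1) (by convert! h using 1; omega)).path _ _).of_homeomorph
      (GenLoop.loopHomeo i)

/-- Generalized loops in the same path component of the loop space are homotopic. -/
theorem GenLoop.Homotopic.of_joined {N X : Type*} [TopologicalSpace X] {x : X}
    {p q : GenLoop N X x} (h : Joined p q) : GenLoop.Homotopic p q := by
  obtain ⟨γ⟩ := h
  refine ⟨⟨⟨⟨fun z => γ z.1 z.2, ?_⟩, fun t => ?_, fun t => ?_⟩, fun t z hz => ?_⟩⟩
  · exact (γ.continuous.comp continuous_fst).eval continuous_snd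
  · simp
  · simp
  · exact ((γ t).2 z hz).trans (p.2 z hz).symm

end LoopSpaces

/-- A quotient of a separable space with open equivalence classes is countable. -/
theorem countable_quotient_of_eventually {A : Type*} [TopologicalSpace A]
    [TopologicalSpace.SeparableSpace A] (s : Setoid A) (h : ∀ a, ∀ᶠ b in 𝓝 a, s a b) :
    Countable (Quotient s) := by
  obtain ⟨D, hD, hdense⟩ := TopologicalSpace.exists_countable_dense A
  have := hD.to_subtype
  refine Function.Surjective.countable (f := fun d : D => Quotient.mk s d) fun c => ?_
  induction c using Quotient.inductionOn with | _ a
  obtain ⟨b, hb, hbD⟩ := mem_closure_iff_nhds.1 (hdense a) _ (h a)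
  exact ⟨⟨b, hbD⟩, Quotient.sound (s.symm hb)⟩

/-- The n-th homotopy group of a connected, locally n-connected separable metric space
is countable. -/
theorem locallyNConnected_countable (X : Type*) [MetricSpace X]
    [TopologicalSpace.SeparableSpace X] [ConnectedSpace X] (n : ℕ) (hn : 1 ≤ n)
    (h : LocallyNConnected n X) (x : X) :
    Countable (HomotopyGroup (Fin n) X x) := by
  have := UniformSpace.secondCountable_of_separable X
  have hloop : SphereLocallyConnected 0 (GenLoop (Fin n) X x) :=
    SphereLocallyConnected.genLoop n (Fin n) (Fintype.card_fin n) 0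
      (by simpa using h.sphereLocallyConnected)
  exact countable_quotient_of_eventually (GenLoop.Homotopic.setoid (Fin n) x) fun p =>
    (hloop.eventually_joined p).mono fun _ => GenLoop.Homotopic.of_joined
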